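/- Fix real numbers 0 ≤ λ_min ≤ λ_max, a ramp rate v̄ > 0, an integer n ≥ 1, and capacity s̄ = n v̄. Define H* : [0, s̄] → ℝ by H*(s) = −((i+1)λ_min + (n−i)λ_max)/(n+1) · s − i(i+1)(λ_max − λ_min) v̄ / (2(n+1)) for s ∈ [i v̄, (i+1) v̄) with i ∈ {0,…,n−1}, and with i = n−1 used for s = s̄. Then for every s ∈ [0, s̄]: (a) the function v ↦ λ_max v + H*(s+v) attains its minimum over v ∈ [max(−s,−v̄), min(v̄, s̄−s)] at v = max(−s, −v̄); and (b) the function v ↦ λ_min v + H*(s+v) attains its minimum over the same interval at v = min(v̄, s̄−s). -/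

import Mathlib

/-- The affine function that agrees with the differential cost on
`[i * vbar, (i + 1) * vbar]`. -/
noncomputable def costPiece (lmin lmax vbar : ℝ) (n i : ℕ) (s : ℝ) : ℝ :=
  -((((i : ℝ) + 1) * lmin + ((n : ℝ) - (i : ℝ)) * lmax) / ((n : ℝ) + 1)) * s
    - (i : ℝ) * ((i : ℝ) + 1) * (lmax - lmin) * vbar / (2 * ((n : ℝ) + 1))

theorem costPiece_sub (lmin lmax vbar : ℝ) (n i j : ℕ) (s : ℝ) :
    costPiece lmin lmax vbar n i s - costPiece lmin lmax vbar n j s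
      = (lmax - lmin) / ((n : ℝ) + 1)
        * (((i : ℝ) - j) * (s - ((i : ℝ) + j + 1) / 2 * vbar)) := by
  unfold costPiece
  have : (n : ℝ) + 1 ≠ 0 := by positivity
  field_simp
  ring

theorem costPiece_le_costPiece {lmin lmax vbar : ℝ} (hl : lmin ≤ lmax) (hvbar : 0 ≤ vbar)
    {n i : ℕ} (j : ℕ) {s : ℝ} (hs : s ∈ Set.Icc ((i : ℝ) * vbar) (((i : ℝ) + 1) * vbar)) :
    costPiece lmin lmax vbar n j s ≤ costPiece lmin lmax vbar n i s := by
  rw [← sub_nonneg, costPiece_sub]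
  refine mul_nonneg (div_nonneg (sub_nonneg.2 hl) (by positivity)) ?_
  obtain ⟨hs₁, hs₂⟩ := hs
  rcases lt_trichotomy i j with h | rfl | h
  · have h' : (i : ℝ) + 1 ≤ j := by exact_mod_cast h
    exact mul_nonneg_of_nonpos_of_nonpos (by linarith) (by nlinarith)
  · simp
  · have h' : (j : ℝ) + 1 ≤ i := by exact_mod_cast h
    exact mul_nonneg (by linarith) (by nlinarith)

theorem monotone_lmax_mul_add_costPiece {lmin lmax : ℝ} (hl : lmin ≤ lmax) (vbar : ℝ) (n i : ℕ) :
    Monotone fun x ↦ lmax * x + costPiece lmin lmax vbar n i x := by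
  intro x y hxy
  have h : 0 ≤ ((i : ℝ) + 1) * (lmax - lmin) / ((n : ℝ) + 1) * (y - x) :=
    mul_nonneg (div_nonneg (mul_nonneg (by positivity) (sub_nonneg.2 hl)) (by positivity))
      (sub_nonneg.2 hxy)
  have e : (lmax * y + costPiece lmin lmax vbar n i y)
      - (lmax * x + costPiece lmin lmax vbar n i x)
      = ((i : ℝ) + 1) * (lmax - lmin) / ((n : ℝ) + 1) * (y - x) := by
    unfold costPiece
    have : (n : ℝ) + 1 ≠ 0 := by positivity
    field_simp
    ring
  exact sub_nonneg.1 (e ▸ h)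

theorem antitone_lmin_mul_add_costPiece {lmin lmax : ℝ} (hl : lmin ≤ lmax) (vbar : ℝ)
    {n i : ℕ} (hi : i ≤ n) :
    Antitone fun x ↦ lmin * x + costPiece lmin lmax vbar n i x := by
  intro x y hxy
  have hi' : (0 : ℝ) ≤ n - i := sub_nonneg.2 (by exact_mod_cast hi)
  have h : 0 ≤ ((n : ℝ) - i) * (lmax - lmin) / ((n : ℝ) + 1) * (y - x) :=
    mul_nonneg (div_nonneg (mul_nonneg hi' (sub_nonneg.2 hl)) (by positivity))
      (sub_nonneg.2 hxy)
  have e : (lmin * x + costPiece lmin lmax vbar n i x)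
      - (lmin * y + costPiece lmin lmax vbar n i y)
      = ((n : ℝ) - i) * (lmax - lmin) / ((n : ℝ) + 1) * (y - x) := by
    unfold costPiece
    have : (n : ℝ) + 1 ≠ 0 := by positivity
    field_simp
    ring
  exact sub_nonneg.1 (e ▸ h)


/-- Claim (A.8) in the proof of Theorem 2: with the piecewise linear
differential cost function `H*`, at the highest price `λ_max` the optimal
ramp-constrained storage action is to sell as much as possible
(`v = max(−s,−v̄)`), and at the lowest price `λ_min` to buy as much as
possible (`v = min(v̄, s̄−s)`). -/
theorem stmt_10
    (lmin lmax vbar : ℝ) (hlmin : 0 ≤ lmin) (hl : lmin ≤ lmax) (hvbar : 0 < vbar)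
    (n : ℕ) (hn : 1 ≤ n)
    (H : ℝ → ℝ)
    (hH : ∀ i : ℕ, i < n →
      ∀ s ∈ Set.Ico ((i : ℝ) * vbar) (((i : ℝ) + 1) * vbar),
        H s = -((((i : ℝ) + 1) * lmin + ((n : ℝ) - (i : ℝ)) * lmax) / ((n : ℝ) + 1)) * s
          - (i : ℝ) * ((i : ℝ) + 1) * (lmax - lmin) * vbar / (2 * ((n : ℝ) + 1)))
    (hHtop : H ((n : ℝ) * vbar)
      = -(((n : ℝ) * lmin + lmax) / ((n : ℝ) + 1)) * ((n : ℝ) * vbar)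
        - ((n : ℝ) - 1) * (n : ℝ) * (lmax - lmin) * vbar / (2 * ((n : ℝ) + 1))) :
    ∀ s ∈ Set.Icc (0 : ℝ) ((n : ℝ) * vbar),
      (max (-s) (-vbar) ∈ Set.Icc (max (-s) (-vbar)) (min vbar ((n : ℝ) * vbar - s)) ∧
        ∀ v ∈ Set.Icc (max (-s) (-vbar)) (min vbar ((n : ℝ) * vbar - s)),
          lmax * max (-s) (-vbar) + H (s + max (-s) (-vbar)) ≤ lmax * v + H (s + v)) ∧
      (min vbar ((n : ℝ) * vbar - s) ∈
          Set.Icc (max (-s) (-vbar)) (min vbar ((n : ℝ) * vbar - s)) ∧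
        ∀ v ∈ Set.Icc (max (-s) (-vbar)) (min vbar ((n : ℝ) * vbar - s)),
          lmin * min vbar ((n : ℝ) * vbar - s) + H (s + min vbar ((n : ℝ) * vbar - s))
            ≤ lmin * v + H (s + v)) := by
  have key : ∀ x ∈ Set.Icc (0 : ℝ) ((n : ℝ) * vbar), ∃ i < n,
      H x = costPiece lmin lmax vbar n i x ∧ ∀ j, costPiece lmin lmax vbar n j x ≤ H x := by
    rintro x ⟨hx₀, hx₁⟩
    rcases hx₁.eq_or_lt with rfl | hx₁
    · obtain ⟨m, rfl⟩ : ∃ m, n = m + 1 := ⟨n - 1, by omega⟩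
      have e : H (((m + 1 : ℕ) : ℝ) * vbar)
          = costPiece lmin lmax vbar (m + 1) m (((m + 1 : ℕ) : ℝ) * vbar) := by
        rw [hHtop, costPiece]
        push_cast
        ring
      refine ⟨m, m.lt_succ_self, e, fun j ↦ e ▸ costPiece_le_costPiece hl hvbar.le j ?_⟩
      push_cast
      exact ⟨by nlinarith, le_rfl⟩
    · have hfl : ((⌊x / vbar⌋₊ : ℕ) : ℝ) * vbar ≤ x :=
        (le_div_iff₀ hvbar).1 (Nat.floor_le (div_nonneg hx₀ hvbar.le))
      have hlt : x < ((⌊x / vbar⌋₊ : ℝ) + 1) * vbar :=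
        (div_lt_iff₀ hvbar).1 (Nat.lt_floor_add_one _)
      have hi : ⌊x / vbar⌋₊ < n :=
        (Nat.floor_lt (div_nonneg hx₀ hvbar.le)).2 ((div_lt_iff₀ hvbar).2 hx₁)
      have e : H x = costPiece lmin lmax vbar n ⌊x / vbar⌋₊ x := hH _ hi x ⟨hfl, hlt⟩
      exact ⟨_, hi, e, fun j ↦ e ▸ costPiece_le_costPiece hl hvbar.le j ⟨hfl, hlt.le⟩⟩
  have hmono : MonotoneOn (fun x ↦ lmax * x + H x) (Set.Icc 0 ((n : ℝ) * vbar)) := by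
    intro x hx y hy hxy
    obtain ⟨i, -, e, -⟩ := key x hx
    obtain ⟨-, -, -, hle⟩ := key y hy
    have := monotone_lmax_mul_add_costPiece hl vbar n i hxy
    have := hle i
    simp only at *
    linarith
  have hanti : AntitoneOn (fun x ↦ lmin * x + H x) (Set.Icc 0 ((n : ℝ) * vbar)) := by
    intro x hx y hy hxy
    obtain ⟨-, -, -, hle⟩ := key x hx
    obtain ⟨i, hi, e, -⟩ := key y hy
    have := antitone_lmin_mul_add_costPiece hl vbar hi.le hxy
    have := hle i
    simp only at *
    linarith
  rintro s ⟨hs₀, hs₁⟩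
  have hne : max (-s) (-vbar) ≤ min vbar ((n : ℝ) * vbar - s) :=
    max_le (le_min (by linarith) (by linarith)) (le_min (by linarith) (by linarith))
  have hmem : ∀ v ∈ Set.Icc (max (-s) (-vbar)) (min vbar ((n : ℝ) * vbar - s)),
      s + v ∈ Set.Icc 0 ((n : ℝ) * vbar) := fun v hv ↦
    ⟨by linarith [(le_max_left _ _).trans hv.1], by linarith [hv.2.trans (min_le_right _ _)]⟩
  have hleft := Set.left_mem_Icc.2 hne
  have hright := Set.right_mem_Icc.2 hne
  refine ⟨⟨hleft, fun v hv ↦ ?_⟩, hright, fun v hv ↦ ?_⟩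
  · have := hmono (hmem _ hleft) (hmem v hv) (add_le_add_right hv.1 s)
    simp only at this
    linarith
  · have := hanti (hmem v hv) (hmem _ hright) (add_le_add_right hv.2 s)
    simp only at this
    linarith
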